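/- arXiv:1412.1126 — 2 statements merged into one kernel-verified Lean document; each statement's English description precedes it below -/
import Mathlib

section
/- Let x₀(t) = √2·sech(t) be the right homoclinic loop of ẍ − x + x³ = 0 and ẋ₀ its derivative. For all real p₁, p₂, p₃ and p₄ > 0, the Melnikov function of Eq. ẍ − ξ + ξ³ = ε[(p₁ + p₂ξ − ξ²)ξ̇ + (3p₃/(1+p₄²))ξ²·sin(p₄ t)], namely Δ₁(t₀) = ∫_{−∞}^{∞} ẋ₀(t)·[ (p₁ + p₂·x₀(t) − x₀(t)²)·ẋ₀(t) + (3p₃/(1+p₄²))·x₀(t)²·sin(p₄(t + t₀)) ] dt, equals Δ₁(t₀) = 2·( (2/3)p₁ + (√2π/8)p₂ − 8/15 ) − (√2·π·p₄·p₃ / cosh(πp₄/2))·cos(p₄ t₀) for every t₀ ∈ ℝ. -/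
/-- The right homoclinic loop of ẍ − x + x³ = 0: x₀(t) = √2·sech(t). -/
noncomputable def x₀ (t : ℝ) : ℝ := Real.sqrt 2 * (1 / Real.cosh t)

open Filter Topology MeasureTheory

theorem tendsto_inv_cosh_atTop : Tendsto (fun t : ℝ => (Real.cosh t)⁻¹) atTop (𝓝 0) := by
  refine tendsto_inv_atTop_zero.comp (tendsto_atTop_mono (f := fun t : ℝ => Real.exp t / 2) ?_ ?_)
  · intro t
    rw [Real.cosh_eq]
    linarith [Real.exp_pos (-t)]
  · exact Real.tendsto_exp_atTop.atTop_div_const two_pos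

theorem tendsto_inv_cosh_atBot : Tendsto (fun t : ℝ => (Real.cosh t)⁻¹) atBot (𝓝 0) := by
  simpa [Function.comp_def] using tendsto_inv_cosh_atTop.comp tendsto_neg_atBot_atTop

theorem tendsto_tanh_atTop_one : Tendsto Real.tanh atTop (𝓝 1) := by
  have h : Tendsto (fun t : ℝ => 1 - Real.exp (-t) * (Real.cosh t)⁻¹) atTop (𝓝 (1 - 0 * 0)) :=
    tendsto_const_nhds.sub (Real.tendsto_exp_neg_atTop_nhds_zero.mul tendsto_inv_cosh_atTop)
  rw [mul_zero, sub_zero] at h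
  refine h.congr fun t => ?_
  have hc := (Real.cosh_pos t).ne'
  rw [← Real.cosh_sub_sinh, Real.tanh_eq_sinh_div_cosh]
  field_simp
  ring

theorem tendsto_tanh_atBot_neg_one : Tendsto Real.tanh atBot (𝓝 (-1)) := by
  simpa [Function.comp_def] using (tendsto_tanh_atTop_one.comp tendsto_neg_atBot_atTop).neg

theorem hasDerivAt_inv_cosh (t : ℝ) :
    HasDerivAt (fun t => (Real.cosh t)⁻¹) (-((Real.cosh t)⁻¹ * Real.tanh t)) t := by
  have hc := (Real.cosh_pos t).ne'
  refine ((Real.hasDerivAt_cosh t).fun_inv hc).congr_deriv ?_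
  rw [Real.tanh_eq_sinh_div_cosh]
  field_simp

theorem tanh_sq_add_inv_cosh_sq (t : ℝ) : Real.tanh t ^ 2 + (Real.cosh t)⁻¹ ^ 2 = 1 := by
  have hc := (Real.cosh_pos t).ne'
  rw [Real.tanh_eq_sinh_div_cosh]
  field_simp
  linarith [Real.cosh_sq t]

theorem hasDerivAt_tanh_inv_cosh_sq (t : ℝ) :
    HasDerivAt Real.tanh ((Real.cosh t)⁻¹ ^ 2) t := by
  have hc := (Real.cosh_pos t).ne'
  have h := (Real.hasDerivAt_sinh t).fun_div (Real.hasDerivAt_cosh t) hc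
  simp_rw [← Real.tanh_eq_sinh_div_cosh] at h
  refine h.congr_deriv ?_
  field_simp
  linarith [Real.cosh_sq t]

theorem continuous_inv_cosh : Continuous fun t : ℝ => (Real.cosh t)⁻¹ :=
  continuous_iff_continuousAt.2 fun t => (hasDerivAt_inv_cosh t).continuousAt

theorem continuous_tanh_real : Continuous Real.tanh :=
  continuous_iff_continuousAt.2 fun t => (hasDerivAt_tanh_inv_cosh_sq t).continuousAt

theorem integrable_inv_cosh : Integrable fun t : ℝ => (Real.cosh t)⁻¹ := by
  refine (integrable_inv_one_add_sq.const_mul 4).mono' continuous_inv_cosh.aestronglyMeasurable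
    (.of_forall fun t => ?_)
  have h : (1 + t ^ 2) / 4 ≤ Real.cosh t := by
    rw [← Real.cosh_abs, Real.cosh_eq]
    have h1 := Real.quadratic_le_exp_of_nonneg (abs_nonneg t)
    rw [sq_abs] at h1
    linarith [Real.exp_pos (-|t|), abs_nonneg t]
  rw [Real.norm_of_nonneg (inv_nonneg.2 (Real.cosh_pos t).le)]
  calc (Real.cosh t)⁻¹ ≤ ((1 + t ^ 2) / 4)⁻¹ := inv_anti₀ (by positivity) h
    _ = 4 * (1 + t ^ 2)⁻¹ := by rw [inv_div, div_eq_mul_inv]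

theorem sigmoid_two_mul (t : ℝ) :
    Real.sigmoid (2 * t) = Real.exp (t - Real.log (2 * Real.cosh t)) := by
  have hc := Real.cosh_pos t
  rw [Real.exp_sub, Real.exp_log (by positivity), Real.sigmoid_def, Real.cosh_eq,
    show -(2 * t) = -t + -t by ring, Real.exp_add, Real.exp_neg]
  have := Real.exp_pos t
  field_simp

theorem one_sub_sigmoid_two_mul (t : ℝ) :
    1 - Real.sigmoid (2 * t) = Real.exp (-t - Real.log (2 * Real.cosh t)) := by
  rw [← Real.sigmoid_neg, ← mul_neg, sigmoid_two_mul, Real.cosh_neg]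

theorem ofReal_exp_cpow (x : ℝ) (z : ℂ) : ((Real.exp x : ℝ) : ℂ) ^ z = Complex.exp (x * z) := by
  rw [Complex.cpow_def_of_ne_zero (by simp), ← Complex.ofReal_log (Real.exp_pos x).le,
    Real.log_exp]

/-- The Fourier transform of the hyperbolic secant. -/
theorem integral_inv_cosh_mul_cexp (ω : ℝ) :
    ∫ t : ℝ, (((Real.cosh t)⁻¹ : ℝ) : ℂ) * Complex.exp (Complex.I * (ω * t)) =
      Real.pi / Real.cosh (Real.pi * ω / 2) := by
  set u : ℂ := 1 / 2 + Complex.I * (ω / 2) with hu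
  have hure : 0 < u.re := by simp [hu]
  have hvre : 0 < (1 - u).re := by simp [hu]; norm_num
  have hbeta : Complex.betaIntegral u (1 - u) = Real.pi / Real.cosh (Real.pi * ω / 2) := by
    have h := Complex.Gamma_mul_Gamma_eq_betaIntegral hure hvre
    rw [add_sub_cancel, Complex.Gamma_one, one_mul, Complex.Gamma_mul_Gamma_one_sub] at h
    rw [← h, Complex.ofReal_cosh, ← Complex.cos_mul_I, ← Complex.sin_add_pi_div_two]
    congr 2
    rw [hu]
    push_cast
    ring
  rw [← hbeta, Complex.betaIntegral, intervalIntegral.integral_of_le zero_le_one,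
    integral_Ioc_eq_integral_Ioo]
  have hderiv : ∀ t ∈ (Set.univ : Set ℝ), HasDerivWithinAt (fun t => Real.sigmoid (2 * t))
      (Real.sigmoid (2 * t) * (1 - Real.sigmoid (2 * t)) * 2) Set.univ t := fun t _ =>
    ((Real.hasDerivAt_sigmoid (2 * t)).comp t
      (by simpa using (hasDerivAt_id t).const_mul 2)).hasDerivWithinAt
  have hmono : Monotone fun t : ℝ => Real.sigmoid (2 * t) := fun a b hab =>
    Real.sigmoid_monotone (by linarith)
  have himage : (fun t : ℝ => Real.sigmoid (2 * t)) '' Set.univ = Set.Ioo 0 1 := by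
    rw [Set.image_univ, ← Real.range_sigmoid]
    exact (mul_left_surjective₀ (two_ne_zero' ℝ)).range_comp Real.sigmoid
  rw [← himage, integral_image_eq_integral_deriv_smul_of_monotoneOn MeasurableSet.univ hderiv
    (hmono.monotoneOn _), setIntegral_univ]
  congr 1 with t
  have hc := Real.cosh_pos t
  have h1 : (1 - (Real.sigmoid (2 * t) : ℂ)) =
      (Real.exp (-t - Real.log (2 * Real.cosh t)) : ℝ) := by
    rw [← one_sub_sigmoid_two_mul]; push_cast; rfl
  rw [h1, one_sub_sigmoid_two_mul, sigmoid_two_mul, ofReal_exp_cpow, ofReal_exp_cpow,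
    ← Complex.exp_add, ← Real.exp_add]
  set L := Real.log (2 * Real.cosh t) with hL
  have hexpL : Real.exp L = 2 * Real.cosh t := Real.exp_log (by positivity)
  have h2 : ((t - L : ℝ) : ℂ) * (u - 1) + ((-t - L : ℝ) : ℂ) * (1 - u - 1) =
      Complex.I * (ω * t) + (L : ℂ) := by
    rw [hu]; push_cast; ring
  have h3 : Real.exp (t - L + (-t - L)) * 2 = (Real.cosh t)⁻¹ * (Real.exp L)⁻¹ := by
    rw [show t - L + (-t - L) = -L + -L by ring, Real.exp_add, Real.exp_neg, hexpL]
    field_simp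
  rw [h2, h3, Complex.exp_add, Complex.real_smul, ← Complex.ofReal_exp]
  have h4 : ((Real.exp L : ℝ) : ℂ) ≠ 0 := by simp
  push_cast at h4 ⊢
  field_simp

theorem integral_inv_cosh_mul_cos (ω a : ℝ) :
    ∫ t : ℝ, (Real.cosh t)⁻¹ * Real.cos (ω * (t + a)) =
      Real.pi / Real.cosh (Real.pi * ω / 2) * Real.cos (ω * a) := by
  have hint : Integrable fun t : ℝ => (((Real.cosh t)⁻¹ : ℝ) : ℂ) *
      Complex.exp (Complex.I * (ω * (t + a))) := by
    refine integrable_inv_cosh.ofReal.mul_bdd (c := 1)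
      (by fun_prop) (.of_forall fun t => le_of_eq ?_)
    rw [mul_comm, ← Complex.norm_exp_ofReal_mul_I (ω * (t + a))]
    push_cast; rfl
  have h := congrArg (· * Complex.exp (Complex.I * (ω * a))) (integral_inv_cosh_mul_cexp ω)
  simp only [← integral_mul_const, mul_assoc, ← Complex.exp_add, ← mul_add] at h
  have hre := congrArg Complex.re h
  have hexp (x : ℝ) : (Complex.exp (Complex.I * (x : ℂ))).re = Real.cos x := by
    rw [mul_comm, Complex.exp_ofReal_mul_I_re]
  rw [← RCLike.re_eq_complex_re, ← integral_re hint] at hre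
  simp only [RCLike.re_eq_complex_re, Complex.re_ofReal_mul] at hre
  norm_cast at hre
  simpa only [Complex.re_ofReal_mul, hexp] using hre

theorem integral_inv_cosh : ∫ t : ℝ, (Real.cosh t)⁻¹ = Real.pi := by
  simpa using integral_inv_cosh_mul_cos 0 0

theorem deriv_x₀ (t : ℝ) : deriv x₀ t = -(Real.sqrt 2 * ((Real.cosh t)⁻¹ * Real.tanh t)) := by
  have h := ((hasDerivAt_inv_cosh t).const_mul (Real.sqrt 2)).deriv
  have hx : x₀ = fun t => Real.sqrt 2 * (Real.cosh t)⁻¹ := by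
    funext t
    rw [x₀, one_div]
  rw [hx, h, mul_neg]

/-- The Melnikov function of the transformed periodically forced equation:
Δ₁(t₀) = ∫ ẋ₀·[(p₁ + p₂x₀ − x₀²)ẋ₀ + (3p₃/(1+p₄²))x₀²·sin(p₄(t+t₀))] dt
       = 2((2/3)p₁ + (√2π/8)p₂ − 8/15) − (√2πp₄p₃/cosh(πp₄/2))·cos(p₄t₀). -/
theorem melnikov_function (p₁ p₂ p₃ p₄ : ℝ) (hp₄ : 0 < p₄) (t₀ : ℝ) :
    ∫ t : ℝ, deriv x₀ t *
        ((p₁ + p₂ * x₀ t - (x₀ t) ^ 2) * deriv x₀ t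
          + (3 * p₃ / (1 + p₄ ^ 2)) * (x₀ t) ^ 2 * Real.sin (p₄ * (t + t₀)))
      = 2 * ((2/3) * p₁ + (Real.sqrt 2 * Real.pi / 8) * p₂ - 8/15)
        - (Real.sqrt 2 * Real.pi * p₄ * p₃ / Real.cosh (Real.pi * p₄ / 2))
          * Real.cos (p₄ * t₀) := by
  have hs2 : Real.sqrt 2 ^ 2 = 2 := Real.sq_sqrt two_pos.le
  set r := Real.sqrt 2 with hr
  have hω : 1 + p₄ ^ 2 ≠ 0 := by positivity
  set s : ℝ → ℝ := fun t => (Real.cosh t)⁻¹ with hs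
  set K := 2 * r * p₃ / (1 + p₄ ^ 2) with hK
  have hscont : Continuous s := continuous_inv_cosh
  have htcont := continuous_tanh_real
  have hs0 (t : ℝ) : 0 ≤ s t := inv_nonneg.2 (Real.cosh_pos t).le
  have hs1 (t : ℝ) : s t ≤ 1 := inv_le_one_of_one_le₀ (Real.one_le_cosh t)
  have hx (t : ℝ) : x₀ t = r * s t := by simp [x₀, hs, hr]
  have hdx (t : ℝ) : deriv x₀ t = -(r * (s t * Real.tanh t)) := deriv_x₀ t
  simp only [hx, hdx]
  set f : ℝ → ℝ := fun t => -(r * (s t * Real.tanh t)) *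
    ((p₁ + p₂ * (r * s t) - (r * s t) ^ 2) * -(r * (s t * Real.tanh t)) +
      3 * p₃ / (1 + p₄ ^ 2) * (r * s t) ^ 2 * Real.sin (p₄ * (t + t₀))) with hf
  set g : ℝ → ℝ := fun t => r * p₂ / 4 * s t -
    r * p₃ * p₄ * (s t * Real.cos (p₄ * (t + t₀))) with hg
  set F : ℝ → ℝ := fun t => p₁ * (2 / 3) * Real.tanh t ^ 3
    + 2 * r * p₂ * (s t * Real.tanh t / 8 - s t ^ 3 * Real.tanh t / 4)
    - (4 / 3 * Real.tanh t ^ 3 - 4 / 5 * Real.tanh t ^ 5)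
    + K * (s t ^ 3 * Real.sin (p₄ * (t + t₀)))
    + K * p₄ / 2 * (-(s t * Real.tanh t) * Real.cos (p₄ * (t + t₀))
      + p₄ * (s t * Real.sin (p₄ * (t + t₀)))) with hF
  have hcosint : Integrable fun t => s t * Real.cos (p₄ * (t + t₀)) :=
    integrable_inv_cosh.mul_bdd (c := 1) (by fun_prop)
      (.of_forall fun t => Real.abs_cos_le_one _)
  have hgint : Integrable g := (integrable_inv_cosh.const_mul _).sub (hcosint.const_mul _)
  have hfint : Integrable f := by
    have hb : Integrable fun t => s t * (-(r * Real.tanh t) *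
      ((p₁ + p₂ * (r * s t) - (r * s t) ^ 2) * -(r * (s t * Real.tanh t)) +
        3 * p₃ / (1 + p₄ ^ 2) * (r * s t) ^ 2 * Real.sin (p₄ * (t + t₀)))) := by
      refine integrable_inv_cosh.mul_bdd (c := (r * 1) *
        ((|p₁| + |p₂| * (r * 1) + (r * 1) ^ 2) * (r * (1 * 1)) +
          |3 * p₃ / (1 + p₄ ^ 2)| * (r * 1) ^ 2 * 1)) (by fun_prop) (.of_forall fun t => ?_)
      have hr0 : 0 ≤ r := Real.sqrt_nonneg 2
      have h1 : |s t| ≤ 1 := by rw [abs_of_nonneg (hs0 t)]; exact hs1 t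
      have h2 : |Real.tanh t| ≤ 1 := (Real.abs_tanh_lt_one t).le
      have h3 := Real.abs_sin_le_one (p₄ * (t + t₀))
      rw [Real.norm_eq_abs, abs_mul, abs_neg, abs_mul, abs_of_nonneg hr0]
      gcongr
      refine (abs_add_le _ _).trans ?_
      rw [abs_mul, abs_neg, abs_mul r, abs_mul (s t), abs_mul, abs_mul, abs_pow, abs_mul r,
        abs_of_nonneg hr0]
      gcongr
      refine (abs_sub _ _).trans ?_
      rw [abs_pow, abs_mul r, abs_of_nonneg hr0]
      gcongr
      refine (abs_add_le _ _).trans ?_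
      rw [abs_mul, abs_mul, abs_of_nonneg hr0]
      gcongr
    refine hb.congr (.of_forall fun t => ?_)
    simp only [hf]
    ring
  have hFderiv (t : ℝ) : HasDerivAt F (f t - g t) t := by
    have ds : HasDerivAt s (-(s t * Real.tanh t)) t := hasDerivAt_inv_cosh t
    have dh : HasDerivAt Real.tanh (s t ^ 2) t := hasDerivAt_tanh_inv_cosh_sq t
    have dθ : HasDerivAt (fun t => p₄ * (t + t₀)) p₄ t := by
      simpa using ((hasDerivAt_id t).add_const t₀).const_mul p₄
    have dsin := dθ.sin
    have dcos := dθ.cos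
    have hid : Real.tanh t ^ 2 = 1 - s t ^ 2 := by
      linarith [tanh_sq_add_inv_cosh_sq t]
    have dF := (((((dh.fun_pow 3).const_mul (p₁ * (2 / 3))).fun_add
      ((((ds.fun_mul dh).div_const 8).fun_sub
        (((ds.fun_pow 3).fun_mul dh).div_const 4)).const_mul (2 * r * p₂))).fun_sub
      (((dh.fun_pow 3).const_mul (4 / 3)).fun_sub ((dh.fun_pow 5).const_mul (4 / 5)))).fun_add
      (((ds.fun_pow 3).fun_mul dsin).const_mul K)).fun_add
      ((((ds.fun_mul dh).fun_neg.fun_mul dcos).fun_add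
        ((ds.fun_mul dsin).const_mul p₄)).const_mul (K * p₄ / 2))
    refine dF.congr_deriv ?_
    have hK1 : 3 * p₃ / (1 + p₄ ^ 2) * r ^ 3 = 3 * K := by
      rw [hK, pow_succ r, hs2]; ring
    have hK2 : r * p₃ = K * (1 + p₄ ^ 2) / 2 := by
      rw [hK]; field_simp
    simp only [hf, hg]
    push_cast
    set h := Real.tanh t
    clear_value K s
    linear_combination -(s t ^ 2 * h ^ 2 * p₁ + p₂ * r * s t ^ 3 * h ^ 2
        - (r ^ 2 + 2) * s t ^ 4 * h ^ 2) * hs2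
      - (2 * r * p₂ * (s t ^ 3 / 4 + s t / 8) - 4 * s t ^ 2 * h ^ 2
        - K * p₄ / 2 * Real.cos (p₄ * (t + t₀)) * s t) * hid
      + s t ^ 3 * h * Real.sin (p₄ * (t + t₀)) * hK1
      - p₄ * s t * Real.cos (p₄ * (t + t₀)) * hK2
  have hs_top : Tendsto s atTop (𝓝 0) := tendsto_inv_cosh_atTop
  have hs_bot : Tendsto s atBot (𝓝 0) := tendsto_inv_cosh_atBot
  have hlim {l : Filter ℝ} {c : ℝ} (h0 : Tendsto s l (𝓝 0)) (h1 : Tendsto Real.tanh l (𝓝 c)) :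
      Tendsto F l (𝓝 (p₁ * (2 / 3) * c ^ 3 - (4 / 3 * c ^ 3 - 4 / 5 * c ^ 5))) := by
    have hsin : Tendsto (fun t => s t * Real.sin (p₄ * (t + t₀))) l (𝓝 0) :=
      h0.zero_mul_isBoundedUnder_le (isBoundedUnder_of ⟨1, fun t => Real.abs_sin_le_one _⟩)
    have hcos : Tendsto (fun t => s t * Real.cos (p₄ * (t + t₀))) l (𝓝 0) :=
      h0.zero_mul_isBoundedUnder_le (isBoundedUnder_of ⟨1, fun t => Real.abs_cos_le_one _⟩)
    have h := (((((h1.pow 3).const_mul (p₁ * (2 / 3))).add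
      ((((h0.mul h1).div_const 8).sub
        (((h0.pow 3).mul h1).div_const 4)).const_mul (2 * r * p₂))).sub
      (((h1.pow 3).const_mul (4 / 3)).sub ((h1.pow 5).const_mul (4 / 5)))).add
      (((h0.pow 2).mul hsin).const_mul K)).add
      (((h1.neg.mul hcos).add (hsin.const_mul p₄)).const_mul (K * p₄ / 2))
    convert h using 2
    · simp only [hF]; ring
    · ring
  have hFint := integral_of_hasDerivAt_of_tendsto hFderiv (hfint.sub hgint)
    (hlim hs_bot tendsto_tanh_atBot_neg_one) (hlim hs_top tendsto_tanh_atTop_one)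
  rw [integral_sub hfint hgint] at hFint
  have hgval : ∫ t, g t = r * p₂ / 4 * Real.pi - r * p₃ * p₄ *
      (Real.pi / Real.cosh (Real.pi * p₄ / 2) * Real.cos (p₄ * t₀)) := by
    rw [hg, integral_sub (integrable_inv_cosh.const_mul _) (hcosint.const_mul _),
      integral_const_mul, integral_const_mul, integral_inv_cosh_mul_cos, integral_inv_cosh]
  rw [hgval] at hFint
  linear_combination hFint
end

section
/- For every nonconstant periodic solution t ↦ (x(t), y(t)) of the unperturbed system ẋ = y, ẏ = x − x³ with energy h = H(x(0), y(0)) > 0 and minimal period T, one has ∫₀^T x(t)·ẋ(t)² dt = 0. Consequently, the Poincaré–Pontryagin generating function B₂(h) = (1/2π)∮_{H=h} (p₁ + p₂x − x²)·y dx in the domain G₂ outside the figure-eight does not depend on the parameter p₂. -/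
/-- The Hamiltonian of the unperturbed Duffing equation: H(x,y) = y²/2 − x²/2 + x⁴/4. -/
noncomputable def H (x y : ℝ) : ℝ := y ^ 2 / 2 - x ^ 2 / 2 + x ^ 4 / 4

/-- Conservation of energy along solutions of the Duffing equation. -/
theorem H_eq_initial {x y : ℝ → ℝ} (hx : ∀ t, HasDerivAt x (y t) t)
    (hy : ∀ t, HasDerivAt y (x t - (x t) ^ 3) t) (t : ℝ) :
    H (x t) (y t) = H (x 0) (y 0) := by
  have hd : ∀ s, HasDerivAt (fun s => H (x s) (y s)) 0 s := fun s => by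
    refine (((((hy s).pow 2).div_const 2).sub (((hx s).pow 2).div_const 2)).add
      (((hx s).pow 4).div_const 4)).congr_deriv ?_
    push_cast
    ring
  exact is_const_of_deriv_eq_zero (fun s => (hd s).differentiableAt) (fun s => (hd s).deriv) t 0

/-- The point `(x² - 1, √2 y)` moves on the circle of radius `R`. Where it avoids `(-R, 0)`, half of
its polar angle is `arctan (√2 y / (R - 1 + x²))`, and has derivative `-(√2 / 2) x`. -/
theorem hasDerivAt_half_angle {x y : ℝ → ℝ} {R t : ℝ} (hx : HasDerivAt x (y t) t)
    (hy : HasDerivAt y (x t - (x t) ^ 3) t) (hR : 1 < R)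
    (hE : 2 * (y t) ^ 2 + ((x t) ^ 2 - 1) ^ 2 = R ^ 2) :
    HasDerivAt (fun s => Real.arctan (√2 * y s / (R - 1 + (x s) ^ 2))) (-(√2 / 2) * x t) t := by
  have hD : 0 < R - 1 + (x t) ^ 2 := by nlinarith [sq_nonneg (x t)]
  have hs : √2 ^ 2 = 2 := Real.sq_sqrt zero_le_two
  refine ((hy.const_mul √2).div ((hx.pow 2).const_add (R - 1)) hD.ne').arctan.congr_deriv ?_
  have hnum : √2 * (x t - x t ^ 3) * (R - 1 + x t ^ 2) - √2 * y t * (2 * x t * y t)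
      = -(√2 * x t * R * (R - 1 + x t ^ 2)) := by
    linear_combination (-√2 * x t) * hE
  have hden : 1 + (√2 * y t / (R - 1 + x t ^ 2)) ^ 2 = 2 * R / (R - 1 + x t ^ 2) := by
    field_simp
    linear_combination hE + y t ^ 2 * hs
  have hR0 : R ≠ 0 := by positivity
  simp only [Pi.div_apply, Pi.pow_apply, Nat.cast_ofNat, Nat.add_one_sub_one, pow_one]
  rw [hden, hnum]
  field_simp

/-- An explicit primitive of `x y²` along a solution of positive energy. -/
theorem hasDerivAt_primitive_mul_sq {x y : ℝ → ℝ} {R t : ℝ} (hx : HasDerivAt x (y t) t)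
    (hy : HasDerivAt y (x t - (x t) ^ 3) t) (hR : 1 < R)
    (hE : 2 * (y t) ^ 2 + ((x t) ^ 2 - 1) ^ 2 = R ^ 2) :
    HasDerivAt (fun s => y s * ((x s) ^ 2 - 1) / 4
      - R ^ 2 * √2 / 4 * Real.arctan (√2 * y s / (R - 1 + (x s) ^ 2))) (x t * (y t) ^ 2) t := by
  have hs : √2 ^ 2 = 2 := Real.sq_sqrt zero_le_two
  refine (((hy.mul ((hx.pow 2).sub_const 1)).div_const 4).sub
    ((hasDerivAt_half_angle hx hy hR hE).const_mul (R ^ 2 * √2 / 4))).congr_deriv ?_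
  simp only [Pi.pow_apply, Nat.cast_ofNat, Nat.add_one_sub_one, pow_one]
  linear_combination (x t * R ^ 2 / 8) * hs - x t / 4 * hE

/-- The integral of `x ẋ²` over any period of a solution of positive energy vanishes. -/
theorem integral_mul_sq_eq_zero {x y : ℝ → ℝ} {T : ℝ} (hx : ∀ t, HasDerivAt x (y t) t)
    (hy : ∀ t, HasDerivAt y (x t - (x t) ^ 3) t) (hxT : x T = x 0) (hyT : y T = y 0)
    (hh : 0 < H (x 0) (y 0)) :
    (∫ t in (0:ℝ)..T, x t * (y t) ^ 2) = 0 := by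
  have hcx : Continuous x := continuous_iff_continuousAt.2 fun t => (hx t).continuousAt
  have hcy : Continuous y := continuous_iff_continuousAt.2 fun t => (hy t).continuousAt
  have hR : 1 < √(4 * H (x 0) (y 0) + 1) := Real.lt_sqrt_of_sq_lt (by linarith)
  have hE : ∀ t, 2 * (y t) ^ 2 + ((x t) ^ 2 - 1) ^ 2 = √(4 * H (x 0) (y 0) + 1) ^ 2 := fun t => by
    rw [Real.sq_sqrt (by linarith), ← H_eq_initial hx hy t, H]
    ring
  rw [intervalIntegral.integral_eq_sub_of_hasDerivAt
    (fun t _ => hasDerivAt_primitive_mul_sq (hx t) (hy t) hR (hE t))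
    (Continuous.intervalIntegrable (by fun_prop) _ _), hxT, hyT, sub_self]

/-- For every nonconstant periodic solution of ẋ = y, ẏ = x − x³ with energy h > 0
(domain G₂ outside the figure-eight) and minimal period T, ∫₀ᵀ x·ẋ² dt = 0; hence the
Poincaré–Pontryagin generating function B₂(h) = (1/2π)∮(p₁ + p₂x − x²)y dx does not
depend on p₂. -/
theorem generating_function_outside (x y : ℝ → ℝ)
    (hx : ∀ t, HasDerivAt x (y t) t)
    (hy : ∀ t, HasDerivAt y (x t - (x t) ^ 3) t)
    (T : ℝ) (hT : 0 < T)
    (hper : ∀ t, x (t + T) = x t ∧ y (t + T) = y t)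
    (hmin : ∀ T', 0 < T' → (∀ t, x (t + T') = x t ∧ y (t + T') = y t) → T ≤ T')
    (hnc : ∃ t₁ t₂, (x t₁, y t₁) ≠ (x t₂, y t₂))
    (hh : 0 < H (x 0) (y 0)) :
    (∫ t in (0:ℝ)..T, x t * (y t) ^ 2) = 0 ∧
    (∀ p₁ p₂ p₂' : ℝ,
      (1 / (2 * Real.pi)) * ∫ t in (0:ℝ)..T, (p₁ + p₂ * x t - (x t) ^ 2) * (y t) ^ 2
        = (1 / (2 * Real.pi)) *
            ∫ t in (0:ℝ)..T, (p₁ + p₂' * x t - (x t) ^ 2) * (y t) ^ 2) := by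
  have hcx : Continuous x := continuous_iff_continuousAt.2 fun t => (hx t).continuousAt
  have hcy : Continuous y := continuous_iff_continuousAt.2 fun t => (hy t).continuousAt
  have hzero : (∫ t in (0:ℝ)..T, x t * (y t) ^ 2) = 0 :=
    integral_mul_sq_eq_zero hx hy (by simpa using (hper 0).1) (by simpa using (hper 0).2) hh
  have hindep : ∀ p₁ p₂ : ℝ, (∫ t in (0:ℝ)..T, (p₁ + p₂ * x t - (x t) ^ 2) * (y t) ^ 2)
      = ∫ t in (0:ℝ)..T, (p₁ - (x t) ^ 2) * (y t) ^ 2 := fun p₁ p₂ => by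
    have hsplit : ∀ t, (p₁ + p₂ * x t - (x t) ^ 2) * (y t) ^ 2
        = (p₁ - (x t) ^ 2) * (y t) ^ 2 + p₂ * (x t * (y t) ^ 2) := fun t => by ring
    simp only [hsplit]
    rw [intervalIntegral.integral_add
      (Continuous.intervalIntegrable (by fun_prop) _ _)
      (Continuous.intervalIntegrable (by fun_prop) _ _),
      intervalIntegral.integral_const_mul, hzero, mul_zero, add_zero]
  exact ⟨hzero, fun p₁ p₂ p₂' => by rw [hindep p₁ p₂, hindep p₁ p₂']⟩
end
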